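/- Let k be a field of characteristic p > 0 that admits infinitely many pairwise inequivalent discrete valuations (nontrivial valuations with value group ℤ). Let L/k be a finite Galois extension, Γ a finite group, and f : Γ → Gal(L/k) a surjective group homomorphism whose kernel is a p-group. Then the embedding problem is properly solvable: there exists a finite Galois extension K of k containing L and a group isomorphism ψ : Gal(K/k) → Γ such that for every σ ∈ Gal(K/k), f(ψ(σ)) equals the restriction of σ to L. -/

import Mathlib

/-- An absolute value (rank-1 valuation) is nonarchimedean if it satisfies the
ultrametric inequality. -/
def AbsoluteValue.IsNonarch {k : Type} [Field k] (v : AbsoluteValue k ℝ) : Prop :=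
  ∀ x y : k, v (x + y) ≤ max (v x) (v y)

/-- Two absolute values on `k` are equivalent (induce the same topology) iff one is a
positive real power of the other. -/
def AbsoluteValue.IsEquivalent {k : Type} [Field k] (v w : AbsoluteValue k ℝ) : Prop :=
  ∃ r : ℝ, 0 < r ∧ ∀ x : k, w x = v x ^ r

/-- A discrete valuation on `k`, encoded as a nonarchimedean absolute value which is
nontrivial and whose value group `v(kˣ)` is the infinite cyclic group `cᶻ` generated by
some real number `0 < c < 1` (so the value group is isomorphic to `ℤ`). -/
def AbsoluteValue.IsDiscrete {k : Type} [Field k] (v : AbsoluteValue k ℝ) : Prop :=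
  v.IsNonarch ∧ ∃ c : ℝ, 0 < c ∧ c < 1 ∧ (∃ x : k, v x = c) ∧
    ∀ x : k, x ≠ 0 → ∃ n : ℤ, v x = c ^ n

/-- The valuation ring of a nonarchimedean absolute value. -/
def AbsoluteValue.IsNonarch.valuationSubring {k : Type} [Field k] {v : AbsoluteValue k ℝ}
    (hv : v.IsNonarch) : ValuationSubring k where
  carrier := {x | v x ≤ 1}
  mul_mem' {a b} ha hb := by
    simpa using mul_le_one₀ ha (v.nonneg b) hb
  one_mem' := by simp
  add_mem' {a b} ha hb := (hv a b).trans (max_le ha hb)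
  zero_mem' := by simp
  neg_mem' {a} ha := by simpa using ha
  mem_or_inv_mem' a := by
    rcases le_total (v a) 1 with h | h
    · exact Or.inl h
    · exact Or.inr (by simpa using inv_le_one_of_one_le₀ h)

theorem AbsoluteValue.IsNonarch.mem_valuationSubring {k : Type} [Field k] {v : AbsoluteValue k ℝ}
    (hv : v.IsNonarch) {x : k} : x ∈ hv.valuationSubring ↔ v x ≤ 1 := Iff.rfl

theorem AbsoluteValue.IsDiscrete.isPrincipalIdealRing {k : Type} [Field k]
    {v : AbsoluteValue k ℝ} (hv : v.IsDiscrete) :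
    IsPrincipalIdealRing hv.1.valuationSubring := by
  classical
  obtain ⟨c, hc0, hc1, -, hval⟩ := hv.2
  refine ⟨fun I => ?_⟩
  by_cases hI : I = ⊥
  · subst hI
    exact bot_isPrincipal
  obtain ⟨x, hxI, hx0⟩ := Submodule.exists_mem_ne_zero_of_ne_bot hI
  have hnat : ∀ x : hv.1.valuationSubring, x ≠ 0 → ∃ n : ℕ, v x = c ^ n := by
    intro x hx
    obtain ⟨n, hn⟩ := hval x (by simpa using hx)
    have hn0 : 0 ≤ n := by
      by_contra! h
      have h1 : v x ≤ 1 := hv.1.mem_valuationSubring.1 x.2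
      have := one_lt_zpow_of_neg₀ hc0 hc1 h
      linarith
    lift n to ℕ using hn0
    exact ⟨n, by simpa using hn⟩
  have hex : ∃ n : ℕ, ∃ x ∈ I, x ≠ 0 ∧ v x = c ^ n := by
    obtain ⟨n, hn⟩ := hnat x hx0
    exact ⟨n, x, hxI, hx0, hn⟩
  obtain ⟨g, hgI, hg0, hg⟩ := Nat.find_spec hex
  refine ⟨g, le_antisymm (fun y hy => ?_) ?_⟩
  · by_cases hy0 : y = 0
    · simp [hy0]
    obtain ⟨m, hm⟩ := hnat y hy0
    have hle : v y ≤ v g := by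
      rw [hm, hg]
      exact pow_le_pow_of_le_one hc0.le hc1.le (Nat.find_min' hex ⟨y, hy, hy0, hm⟩)
    have hg0' : (g : k) ≠ 0 := by simpa using hg0
    have hmem : (y : k) / g ∈ hv.1.valuationSubring := by
      rw [hv.1.mem_valuationSubring, map_div₀]
      exact div_le_one_of_le₀ hle (v.nonneg _)
    refine Ideal.mem_span_singleton'.2 ⟨⟨_, hmem⟩, Subtype.ext ?_⟩
    simp [hg0']
  · exact (Ideal.span_singleton_le_iff_mem I).2 hgI

open IsDedekindDomain in
/-- A discrete absolute value on `k` extends to a discrete valuation on any finite separable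
extension of `k`. -/
theorem AbsoluteValue.IsDiscrete.exists_valuation {k : Type} [Field k]
    {v : AbsoluteValue k ℝ} (hv : v.IsDiscrete) (L : Type) [Field L] [Algebra k L]
    [FiniteDimensional k L] [Algebra.IsSeparable k L] :
    ∃ w : Valuation L (WithZero (Multiplicative ℤ)),
      (∃ t : k, t ≠ 0 ∧ w (algebraMap k L t) < 1) ∧ ∃ π : L, w π = WithZero.exp (-1) := by
  have := hv.isPrincipalIdealRing
  set O := hv.1.valuationSubring with hO
  obtain ⟨c, hc0, hc1, ⟨x, hx⟩, -⟩ := hv.2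
  have hx0 : x ≠ 0 := by
    rintro rfl
    simp at hx
    linarith
  have hxO : x ∈ O := hv.1.mem_valuationSubring.2 (by linarith)
  let B := integralClosure O L
  have : IsDedekindDomain B := integralClosure.isDedekindDomain O k L
  have : IsFractionRing B L := integralClosure.isFractionRing_of_finite_extension k L
  have hinj : Function.Injective (algebraMap O B) := fun a b h =>
    Subtype.ext ((algebraMap k L).injective (congrArg Subtype.val h))
  have hmax : (⟨x, hxO⟩ : O) ∈ IsLocalRing.maximalIdeal O := by
    rw [IsLocalRing.mem_maximalIdeal, mem_nonunits_iff]
    intro hu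
    obtain ⟨y, hy⟩ := hu.exists_right_inv
    have h1 : v x * v y = 1 := by
      have := congrArg (fun z : O => v z) hy
      simpa using this
    have h2 : v y ≤ 1 := hv.1.mem_valuationSubring.1 y.2
    nlinarith [v.nonneg (y : k)]
  obtain ⟨Q, hQ, hQx⟩ := Ideal.exists_ideal_over_maximal_of_isIntegral (R := O) (S := B)
    (IsLocalRing.maximalIdeal O) (by
      rw [(RingHom.injective_iff_ker_eq_bot _).1 (hinj)]
      exact bot_le)
  have hxQ : algebraMap O B ⟨x, hxO⟩ ∈ Q := by
    rw [← Ideal.mem_comap, hQx]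
    exact hmax
  let P : HeightOneSpectrum B := ⟨Q, hQ.isPrime, fun h => by
    rw [h, Ideal.mem_bot, map_eq_zero_iff _ (hinj)] at hxQ
    exact hx0 (congrArg Subtype.val hxQ)⟩
  refine ⟨P.valuation L, ⟨x, hx0, ?_⟩, P.valuation_exists_uniformizer L⟩
  exact (P.valuation_lt_one_iff_mem (K := L) (algebraMap O B ⟨x, hxO⟩)).2 hxQ

/-- The closure of the subring of `p`-th powers with respect to a valuation. -/
def Valuation.pthPowerClosure {L Γ₀ : Type*} [Field L] [LinearOrderedCommGroupWithZero Γ₀]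
    (w : Valuation L Γ₀) (p : ℕ) [Fact p.Prime] [CharP L p] : Subring L where
  carrier := {x | ∀ γ : Γ₀, γ ≠ 0 → ∃ s : L, w (x - s ^ p) < γ}
  zero_mem' γ hγ := ⟨0, by
    simpa [(Fact.out : p.Prime).ne_zero] using zero_lt_iff.2 hγ⟩
  one_mem' γ hγ := ⟨1, by simpa using zero_lt_iff.2 hγ⟩
  neg_mem' {x} hx γ hγ := by
    obtain ⟨s, hs⟩ := hx γ hγ
    refine ⟨-s, ?_⟩
    have h : (-s) ^ p = -s ^ p := by
      simpa only [frobenius_def] using _root_.map_neg (frobenius L p) s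
    rwa [h, ← neg_sub', Valuation.map_neg]
  add_mem' {x y} hx hy γ hγ := by
    obtain ⟨s, hs⟩ := hx γ hγ
    obtain ⟨t, ht⟩ := hy γ hγ
    refine ⟨s + t, ?_⟩
    rw [add_pow_char, add_sub_add_comm]
    exact w.map_add_lt hs ht
  mul_mem' {x y} hx hy γ hγ := by
    have hx1 : 0 < max (w x) 1 := lt_max_of_lt_right one_pos
    have hy1 : 0 < max (w y) 1 := lt_max_of_lt_right one_pos
    obtain ⟨t, ht⟩ := hy (min (γ / max (w x) 1) 1)
      (lt_min (div_pos (zero_lt_iff.2 hγ) hx1) one_pos).ne'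
    obtain ⟨s, hs⟩ := hx (γ / max (w y) 1) (div_pos (zero_lt_iff.2 hγ) hy1).ne'
    refine ⟨s * t, ?_⟩
    have h : x * y - (s * t) ^ p = x * (y - t ^ p) + t ^ p * (x - s ^ p) := by ring
    have htp : w (t ^ p) ≤ max (w y) 1 := by
      have h : t ^ p = y - (y - t ^ p) := by ring
      rw [h]
      exact (w.map_sub _ _).trans (max_le_max le_rfl (ht.le.trans (min_le_right _ _)))
    rw [h]
    refine w.map_add_lt ?_ ?_
    · rw [map_mul]
      calc w x * w (y - t ^ p) ≤ max (w x) 1 * w (y - t ^ p) := by gcongr; exact le_max_left _ _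
        _ < γ := by
          rw [← lt_div_iff₀' hx1]
          exact ht.trans_le (min_le_left _ _)
    · rw [map_mul]
      calc w (t ^ p) * w (x - s ^ p) ≤ max (w y) 1 * w (x - s ^ p) := by gcongr
        _ < γ := by rwa [← lt_div_iff₀' hy1]

theorem Valuation.pow_mem_pthPowerClosure {L Γ₀ : Type*} [Field L]
    [LinearOrderedCommGroupWithZero Γ₀] (w : Valuation L Γ₀) (p : ℕ) [Fact p.Prime] [CharP L p]
    (x : L) : x ^ p ∈ w.pthPowerClosure p :=
  fun γ hγ => ⟨x, by simpa using zero_lt_iff.2 hγ⟩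

theorem Valuation.inv_mem_pthPowerClosure {L Γ₀ : Type*} [Field L]
    [LinearOrderedCommGroupWithZero Γ₀] (w : Valuation L Γ₀) (p : ℕ) [Fact p.Prime] [CharP L p]
    {x : L} (hx : x ∈ w.pthPowerClosure p) : x⁻¹ ∈ w.pthPowerClosure p := by
  by_cases hx0 : x = 0
  · simp [hx0]
  have hp := (Fact.out : p.Prime).one_lt
  have h : x⁻¹ = x ^ (p - 1) * x⁻¹ ^ p := by
    obtain ⟨q, rfl⟩ : ∃ q, p = q + 1 := ⟨p - 1, by omega⟩
    rw [Nat.add_sub_cancel, pow_succ, ← mul_assoc, ← mul_pow, mul_inv_cancel₀ hx0, one_pow,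
      one_mul]
  rw [h]
  exact mul_mem (pow_mem hx _) (w.pow_mem_pthPowerClosure p _)

/-- If `k ⊆ L` is separable and the closure of the `p`-th powers of `L` contains `k`, then it is
all of `L`. -/
theorem Valuation.mem_pthPowerClosure_of_forall_algebraMap_mem {k L Γ₀ : Type*} [Field k] [Field L]
    [Algebra k L] [Algebra.IsSeparable k L] [LinearOrderedCommGroupWithZero Γ₀]
    (w : Valuation L Γ₀) (p : ℕ) [Fact p.Prime] [CharP k p] [CharP L p]
    (h : ∀ t : k, algebraMap k L t ∈ w.pthPowerClosure p) (x : L) :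
    x ∈ w.pthPowerClosure p := by
  let C : IntermediateField k L :=
    { w.pthPowerClosure p with
      algebraMap_mem' := h
      inv_mem' := fun _ hx => w.inv_mem_pthPowerClosure p hx }
  have hle : IntermediateField.adjoin k ((· ^ p) '' (Set.univ : Set L)) ≤ C := by
    rw [IntermediateField.adjoin_le_iff]
    rintro _ ⟨y, -, rfl⟩
    exact w.pow_mem_pthPowerClosure p y
  rw [← IntermediateField.adjoin_eq_adjoin_pow_expChar_of_isSeparable' k L Set.univ p] at hle
  exact hle (IntermediateField.subset_adjoin k _ (Set.mem_univ x))

theorem Valuation.mem_pthPowerClosure_of_artinSchreier {L Γ₀ : Type*} [Field L]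
    [LinearOrderedCommGroupWithZero Γ₀] [MulArchimedean Γ₀] (w : Valuation L Γ₀) (p : ℕ)
    [Fact p.Prime] [CharP L p] {t₀ : L} (ht₀ : t₀ ≠ 0) (hw : w t₀ < 1) {u : L}
    (h : ∀ n : ℕ, ∃ s : L, s ^ p - s = (t₀⁻¹ ^ n) ^ p * u) : u ∈ w.pthPowerClosure p := by
  intro γ hγ
  have hp := (Fact.out : p.Prime).two_le
  set M := max (w u) 1 with hM
  have hM0 : 0 < M := lt_max_of_lt_right one_pos
  have hM1 : 1 ≤ M := le_max_right _ _
  obtain ⟨n, hn⟩ := exists_pow_lt₀ hw (Units.mk0 (γ / M) (div_pos (zero_lt_iff.2 hγ) hM0).ne')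
  rw [Units.val_mk0, lt_div_iff₀' hM0] at hn
  obtain ⟨s, hs⟩ := h n
  set τ := t₀⁻¹ ^ n with hτ
  have hτ0 : τ ≠ 0 := by positivity
  have hwτ0 : 0 < w τ := zero_lt_iff.2 ((w.ne_zero_iff).2 hτ0)
  have hτ1 : 1 ≤ w τ := by
    rw [hτ, map_pow, map_inv₀]
    exact one_le_pow₀ ((one_le_inv₀ (zero_lt_iff.2 ((w.ne_zero_iff).2 ht₀))).2 hw.le)
  have hsle : w s ≤ M * w τ := by
    by_contra! hlt
    have h1 : 1 < w s := (one_le_mul hM1 hτ1).trans_lt hlt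
    have h2 : w s < w (s ^ p) := by
      rw [map_pow]
      exact lt_self_pow₀ h1 (by omega)
    have h3 : w (s ^ p - s) = w (s ^ p) := w.map_sub_eq_of_lt_left h2
    have h4 : (M * w τ) ^ p < w s ^ p := pow_lt_pow_left₀ hlt zero_le (by omega)
    rw [hs, map_mul, map_pow w τ, map_pow w s] at h3
    have h5 : w τ ^ p * w u ≤ (M * w τ) ^ p := by
      rw [mul_pow, mul_comm]
      gcongr
      exact (le_max_left _ _).trans (le_self_pow₀ hM1 (by omega))
    exact (h5.trans_lt h4).ne h3
  refine ⟨s / τ, ?_⟩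
  have h6 : u - (s / τ) ^ p = -(s / τ ^ p) := by
    rw [sub_eq_iff_eq_add] at hs
    rw [div_pow, hs]
    field_simp
    ring
  rw [h6, Valuation.map_neg, map_div₀, map_pow]
  calc w s / w τ ^ p ≤ M * w τ / w τ ^ 2 := by
        have h7 : w τ ^ 2 ≤ w τ ^ p := pow_le_pow_right₀ hτ1 hp
        have h8 : 0 < w τ ^ 2 := pow_pos hwτ0 2
        gcongr
    _ = M * w t₀ ^ n := by
        rw [sq, mul_div_mul_right _ _ hwτ0.ne', hτ, map_pow, map_inv₀, inv_pow, div_inv_eq_mul]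
    _ < γ := hn

theorem exists_forall_artinSchreier_ne {k L : Type*} [Field k] [Field L] [Algebra k L]
    [Algebra.IsSeparable k L] (p : ℕ) [Fact p.Prime] [CharP k p] [CharP L p]
    (w : Valuation L (WithZero (Multiplicative ℤ)))
    (hw : ∃ t : k, t ≠ 0 ∧ w (algebraMap k L t) < 1) (hπ : ∃ π : L, w π = WithZero.exp (-1))
    {u : L} (hu : u ≠ 0) : ∃ t : k, ∀ s : L, s ^ p - s ≠ t • u := by
  by_contra! H
  obtain ⟨t₀, ht₀, hwt₀⟩ := hw
  obtain ⟨π, hπ⟩ := hπ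
  have key : ∀ t : k, t • u ∈ w.pthPowerClosure p := by
    intro t
    refine w.mem_pthPowerClosure_of_artinSchreier p (t₀ := algebraMap k L t₀) (by simpa) hwt₀
      fun n => ?_
    obtain ⟨s, hs⟩ := H ((t₀⁻¹ ^ n) ^ p * t)
    refine ⟨s, hs.trans ?_⟩
    simp [Algebra.smul_def, mul_assoc]
  have hk : ∀ t : k, algebraMap k L t ∈ w.pthPowerClosure p := by
    intro t
    have := mul_mem (key t) (w.inv_mem_pthPowerClosure p (by simpa using key 1))
    rwa [smul_mul_assoc, mul_inv_cancel₀ hu, Algebra.smul_def, mul_one] at this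
  obtain ⟨s, hs⟩ := w.mem_pthPowerClosure_of_forall_algebraMap_mem p hk π (WithZero.exp (-1))
    WithZero.exp_ne_zero
  have h1 : w (s ^ p) = WithZero.exp (-1) := by
    rw [← hπ, w.map_sub_swap] at hs
    rw [← hπ, w.map_eq_of_sub_lt hs]
  have hs0 : w s ≠ 0 := by
    intro h0
    rw [map_pow, h0, zero_pow (Fact.out : p.Prime).ne_zero] at h1
    exact WithZero.exp_ne_zero h1.symm
  rw [map_pow, ← WithZero.exp_log hs0, ← WithZero.exp_nsmul, WithZero.exp_inj] at h1
  have hdvd : (p : ℤ) ∣ 1 := ⟨-WithZero.log (w s), by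
    rw [nsmul_eq_mul] at h1
    linarith⟩
  exact (Fact.out : p.Prime).one_lt.ne' (by
    exact_mod_cast Int.eq_one_of_dvd_one (by positivity) hdvd)

/-- The additive map on `ι → E` given by applying `g` coordinatewise and then a matrix over
`ZMod p`. -/
def semilinearAct {p : ℕ} {ι E F : Type*} [Fintype ι] [AddCommGroup E] [AddCommGroup F]
    [Module (ZMod p) F] (M : Matrix ι ι (ZMod p)) (g : E →+ F) : (ι → E) →+ (ι → F) where
  toFun v i := ∑ j, M i j • g (v j)
  map_zero' := by ext; simp
  map_add' v w := by ext; simp [Finset.sum_add_distrib]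

theorem semilinearAct_apply {p : ℕ} {ι E F : Type*} [Fintype ι] [AddCommGroup E] [AddCommGroup F]
    [Module (ZMod p) F] (M : Matrix ι ι (ZMod p)) (g : E →+ F) (v : ι → E) (i : ι) :
    semilinearAct M g v i = ∑ j, M i j • g (v j) := rfl

theorem semilinearAct_semilinearAct {p : ℕ} {ι E F H : Type*} [Fintype ι] [AddCommGroup E]
    [AddCommGroup F] [AddCommGroup H] [Module (ZMod p) F] [Module (ZMod p) H]
    (M N : Matrix ι ι (ZMod p)) (g : F →+ H) (h : E →+ F) (v : ι → E) :
    semilinearAct M g (semilinearAct N h v) = semilinearAct (M * N) (g.comp h) v := by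
  ext i
  simp only [semilinearAct_apply, map_sum, ZMod.map_smul, Finset.smul_sum, Matrix.mul_apply,
    Finset.sum_smul, mul_smul, AddMonoidHom.comp_apply]
  exact Finset.sum_comm

theorem semilinearAct_one {p : ℕ} {ι E : Type*} [Fintype ι] [DecidableEq ι] [AddCommGroup E]
    [Module (ZMod p) E] (v : ι → E) :
    semilinearAct (1 : Matrix ι ι (ZMod p)) (AddMonoidHom.id E) v = v := by
  ext i
  simp [semilinearAct_apply, Matrix.one_apply, ite_smul]

theorem map_semilinearAct {p : ℕ} {ι E E' F F' : Type*} [Fintype ι] [AddCommGroup E]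
    [AddCommGroup E'] [AddCommGroup F] [AddCommGroup F'] [Module (ZMod p) F] [Module (ZMod p) F']
    (M : Matrix ι ι (ZMod p)) {g : E →+ F} {g' : E' →+ F'} {φ : F →+ F'} {ψ : E →+ E'}
    (h : ∀ x, φ (g x) = g' (ψ x)) (v : ι → E) (i : ι) :
    φ (semilinearAct M g v i) = semilinearAct M g' (fun j => ψ (v j)) i := by
  simp only [semilinearAct_apply, map_sum, ZMod.map_smul, h]

theorem semilinearAct_smul_one {p : ℕ} {ι E : Type*} [Fintype ι] [Ring E]
    [Module (ZMod p) E] (M : Matrix ι ι (ZMod p)) (g : E →+* E) (c : ι → ZMod p) :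
    semilinearAct M (g : E →+ E) (fun i => c i • (1 : E)) =
      fun i => (M.mulVec c) i • (1 : E) := by
  ext i
  simp [semilinearAct_apply, ZMod.map_smul, Matrix.mulVec, dotProduct, Finset.sum_smul, mul_smul]

theorem semilinearAct_mul {p : ℕ} {ι E : Type*} [Fintype ι] [Ring E]
    [Algebra (ZMod p) E] (M : Matrix ι ι (ZMod p)) (g : E →+* E) (l : E) (v : ι → E) :
    semilinearAct M (g : E →+ E) (l • v) = g l • semilinearAct M (g : E →+ E) v := by
  ext i
  simp [semilinearAct_apply, Finset.mul_sum]

/-- The Artin-Schreier map `x ↦ x ^ p - x`. -/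
def artinSchreier (p : ℕ) (E : Type*) [CommRing E] [ExpChar E p] : E →+ E :=
  (frobenius E p : E →+ E) - AddMonoidHom.id E

theorem artinSchreier_apply (p : ℕ) {E : Type*} [CommRing E] [ExpChar E p] (x : E) :
    artinSchreier p E x = x ^ p - x := rfl

theorem map_artinSchreier (p : ℕ) {E F : Type*} [CommRing E] [CommRing F] [ExpChar E p]
    [ExpChar F p] (g : E →+* F) (x : E) :
    g (artinSchreier p E x) = artinSchreier p F (g x) := by
  simp [artinSchreier_apply]

theorem artinSchreier_eq_zero_iff (p : ℕ) [Fact p.Prime] {E : Type*} [Field E] [CharP E p]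
    [Algebra (ZMod p) E] {x : E} :
    artinSchreier p E x = 0 ↔ ∃ c : ZMod p, c • (1 : E) = x := by
  rw [artinSchreier_apply, sub_eq_zero]
  constructor
  · intro h
    rw [← Subfield.mem_bot_iff_pow_eq_self] at h
    rw [← ZMod.fieldRange_castHom_eq_bot p] at h
    obtain ⟨c, hc⟩ := h
    refine ⟨c, ?_⟩
    rw [← Algebra.algebraMap_eq_smul_one, ← hc]
    exact congrArg (fun g : ZMod p →+* E => g c) (Subsingleton.elim _ _)
  · rintro ⟨c, rfl⟩
    rw [← Algebra.algebraMap_eq_smul_one, ← map_pow, ZMod.pow_card]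

theorem artinSchreier_semilinearAct {p : ℕ} {ι E F : Type*} [Fintype ι] [CommRing E] [CommRing F]
    [ExpChar E p] [ExpChar F p] [Module (ZMod p) F] (M : Matrix ι ι (ZMod p)) (g : E →+* F)
    (v : ι → E) (i : ι) :
    artinSchreier p F (semilinearAct M (g : E →+ F) v i) =
      semilinearAct M (g : E →+ F) (fun j => artinSchreier p E (v j)) i :=
  map_semilinearAct M (fun x => (map_artinSchreier p g x).symm) v i

section Cohomology

variable {p : ℕ} {k L : Type*} [Field k] [Field L] [Algebra k L]
  [Algebra (ZMod p) L] {Γ : Type*} [Group Γ] (f : Γ →* (L ≃ₐ[k] L))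
  {ι : Type*} [Fintype ι]

/-- The action of `Γ` on `ι → L` attached to a matrix representation of `Γ` over `ZMod p`. -/
abbrev galAct (ρ : Γ → Matrix ι ι (ZMod p)) (γ : Γ) : (ι → L) →+ (ι → L) :=
  semilinearAct (ρ γ) ((f γ : L →+* L) : L →+ L)

theorem galAct_mul [DecidableEq ι] (ρ : Γ →* Matrix ι ι (ZMod p)) (γ δ : Γ) (v : ι → L) :
    galAct f ρ (γ * δ) v = galAct f ρ γ (galAct f ρ δ v) := by
  rw [semilinearAct_semilinearAct, galAct, map_mul, map_mul]
  rfl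

theorem galAct_of_mem_ker [DecidableEq ι] (ρ : Γ →* Matrix ι ι (ZMod p)) {a : Γ} (ha : a ∈ f.ker)
    (hρ : ρ a = 1) (v : ι → L) : galAct f ρ a v = v := by
  rw [MonoidHom.mem_ker] at ha
  rw [galAct, hρ, ha]
  exact semilinearAct_one v

theorem exists_galAct_eq_self_and_artinSchreier_ne [FiniteDimensional k L] [ExpChar L p]
    (hf : Function.Surjective f)
    [DecidableEq ι] [Nonempty ι]
    (ρ : Γ →* Matrix ι ι (ZMod p)) (hρ : ∀ a ∈ f.ker, ρ a = 1)
    (hL : ∀ u : L, u ≠ 0 → ∃ t : k, ∀ s : L, artinSchreier p L s ≠ t • u) :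
    ∃ z : ι → L, (∀ γ, galAct f ρ γ z = z) ∧
      ∀ x : ι → L, (fun i => artinSchreier p L (x i)) ≠ z := by
  choose s hs using hf
  obtain ⟨i⟩ := ‹Nonempty ι›
  let z : L → ι → L := fun l =>
    ∑ τ, galAct f ρ (s τ) (l • fun j => (Pi.single i 1 : ι → ZMod p) j • 1)
  have hz : ∀ l γ, galAct f ρ γ (z l) = z l := by
    intro l γ
    simp only [z, map_sum, ← galAct_mul]
    refine Fintype.sum_equiv (Equiv.mulLeft (f γ)) _ _ fun τ => ?_
    have h3 : γ * s τ = s (f γ * τ) * ((s (f γ * τ))⁻¹ * (γ * s τ)) := by group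
    have hmem : (s (f γ * τ))⁻¹ * (γ * s τ) ∈ f.ker := by simp [MonoidHom.mem_ker, hs]
    rw [h3, galAct_mul, galAct_of_mem_ker f ρ hmem (hρ _ hmem)]
    rfl
  have hzi : ∀ l, z l i = ∑ τ : L ≃ₐ[k] L, (ρ (s τ) i i • (1 : L)) * τ l := by
    intro l
    simp only [z, Finset.sum_apply, galAct, semilinearAct_mul, semilinearAct_smul_one, hs,
      Pi.smul_apply, Matrix.mulVec_single_one, Matrix.col_apply]
    exact Finset.sum_congr rfl fun τ _ => mul_comm _ _
  have hne : ∃ l, z l i ≠ 0 := by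
    by_contra! h
    have hli := (linearIndependent_monoidHom L L).comp
      (fun τ : L ≃ₐ[k] L => (τ : L →* L))
      (fun σ τ h => AlgEquiv.ext fun x => DFunLike.congr_fun h x)
    rw [Fintype.linearIndependent_iff] at hli
    have := hli (fun τ => ρ (s τ) i i • (1 : L)) (by
      ext l
      simpa [hzi] using h l) 1
    have hs1 : s 1 ∈ f.ker := by simp [MonoidHom.mem_ker, hs]
    rw [hρ _ hs1] at this
    simp at this
  obtain ⟨l, hl⟩ := hne
  obtain ⟨t, ht⟩ := hL _ hl
  refine ⟨z (t • l), hz _, fun x hx => ht (x i) ?_⟩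
  rw [congrFun hx i, hzi, hzi, Finset.smul_sum]
  simp

variable [FiniteDimensional k L] [IsGalois k L]

variable (k L) in
theorem exists_sum_galois_eq_one : ∃ θ : L, ∑ σ : L ≃ₐ[k] L, σ θ = 1 := by
  obtain ⟨θ, hθ⟩ := Algebra.trace_surjective k L 1
  exact ⟨θ, by rw [← trace_eq_sum_automorphisms, hθ, map_one]⟩

/-- A function on an extension of `Gal(L/k)` by an elementary abelian `p`-group can be chosen to be
a cocycle with values in `ι → L` which on the kernel is a given coordinate isomorphism. -/
theorem exists_cocycle_extending (hf : Function.Surjective f) [DecidableEq ι]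
    (ρ : Γ →* Matrix ι ι (ZMod p)) (e : f.ker → ι → ZMod p)
    (he : ∀ a b, e (a * b) = e a + e b)
    (hconj : ∀ (γ : Γ) (a b : f.ker), (b : Γ) = γ * a * γ⁻¹ → e b = (ρ γ).mulVec (e a)) :
    ∃ β : Γ → ι → L, (∀ γ δ, β (γ * δ) = β γ + galAct f ρ γ (β δ)) ∧
      ∀ a : f.ker, β a = fun i => e a i • 1 := by
  obtain ⟨θ, hθ⟩ := exists_sum_galois_eq_one k L
  choose s hs using hf
  have hmem : ∀ γ τ, γ * s τ * (s (f γ * τ))⁻¹ ∈ f.ker := fun γ τ => by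
    simp [MonoidHom.mem_ker, hs]
  let α : Γ → (L ≃ₐ[k] L) → f.ker := fun γ τ => ⟨_, hmem γ τ⟩
  refine ⟨fun γ => ∑ τ, (f γ * τ) θ • fun i => e (α γ τ) i • (1 : L), fun γ δ => ?_, fun a => ?_⟩
  · have hα : ∀ τ, e (α (γ * δ) τ) = (ρ γ).mulVec (e (α δ τ)) + e (α γ (f δ * τ)) := by
      intro τ
      have hb : γ * (α δ τ : Γ) * γ⁻¹ ∈ f.ker :=
        (MonoidHom.normal_ker f).conj_mem _ (α δ τ).2 γ
      rw [← hconj γ (α δ τ) ⟨_, hb⟩ rfl, ← he]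
      congr 1
      apply Subtype.ext
      simp [α, mul_assoc]
    have h1 : ∑ τ, (f γ * τ) θ • (fun i => e (α γ τ) i • (1 : L)) =
        ∑ τ, (f γ * (f δ * τ)) θ • fun i => e (α γ (f δ * τ)) i • (1 : L) :=
      (Equiv.sum_comp (Equiv.mulLeft (f δ))
        (fun τ => (f γ * τ) θ • fun i => e (α γ τ) i • (1 : L))).symm
    beta_reduce
    rw [h1, map_sum, ← Finset.sum_add_distrib]
    refine Finset.sum_congr rfl fun τ _ => ?_
    rw [galAct, semilinearAct_mul, semilinearAct_smul_one, hα, map_mul, mul_assoc]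
    change _ = _ + (f γ * (f δ * τ)) θ • _
    rw [add_comm, ← smul_add]
    congr 1
    ext i
    simp [add_smul]
  · have ha : f a = 1 := a.2
    have hα : ∀ τ, α a τ = a := fun τ => Subtype.ext (by simp [α, ha])
    simp_rw [hα, ha, one_mul]
    rw [← Finset.sum_smul, hθ, one_smul]

theorem exists_eq_sub_galAct (hf : Function.Surjective f) [DecidableEq ι]
    (ρ : Γ →* Matrix ι ι (ZMod p)) {κ : Γ → ι → L}
    (hκ : ∀ γ δ, κ (γ * δ) = κ γ + galAct f ρ γ (κ δ)) (hker : ∀ a ∈ f.ker, κ a = 0) :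
    ∃ y : ι → L, ∀ γ, κ γ = y - galAct f ρ γ y := by
  obtain ⟨θ, hθ⟩ := exists_sum_galois_eq_one k L
  choose s hs using hf
  refine ⟨∑ τ : L ≃ₐ[k] L, τ θ • κ (s τ), fun γ => ?_⟩
  have h1 : ∀ τ, galAct f ρ γ (τ θ • κ (s τ)) = (f γ * τ) θ • (κ (s (f γ * τ)) - κ γ) := by
    intro τ
    have h2 : κ (s (f γ * τ)) = κ (γ * s τ) := by
      have h3 : s (f γ * τ) = γ * s τ * ((γ * s τ)⁻¹ * s (f γ * τ)) := by group
      rw [h3, hκ (γ * s τ), hker ((γ * s τ)⁻¹ * s (f γ * τ)), map_zero, add_zero]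
      simp [MonoidHom.mem_ker, hs]
    rw [h2, hκ, add_sub_cancel_left, galAct, semilinearAct_mul]
    rfl
  rw [map_sum]
  simp_rw [h1]
  have h4 : ∑ τ, (f γ * τ) θ • (κ (s (f γ * τ)) - κ γ) =
      ∑ τ : L ≃ₐ[k] L, τ θ • (κ (s τ) - κ γ) :=
    Equiv.sum_comp (Equiv.mulLeft (f γ)) fun τ : L ≃ₐ[k] L => τ θ • (κ (s τ) - κ γ)
  rw [h4]
  simp_rw [smul_sub, Finset.sum_sub_distrib]
  rw [← Finset.sum_smul, hθ, one_smul, sub_sub_cancel]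

end Cohomology

/-- A cocycle on `Γ` with values in `ι → L` which identifies the kernel of `f : Γ → Gal(L/k)` with
`ι → ZMod p`, together with a vector `y` whose coboundary is its image under `artinSchreier`. -/
structure ArtinSchreierCocycle (p : ℕ) {k L : Type*} [Field k] [Field L] [Algebra k L]
    [Algebra (ZMod p) L] [ExpChar L p] {Γ : Type*} [Group Γ] (f : Γ →* (L ≃ₐ[k] L))
    (ι : Type*) [Fintype ι] [DecidableEq ι] where
  ρ : Γ →* Matrix ι ι (ZMod p)
  ρ_ker : ∀ a ∈ f.ker, ρ a = 1
  β : Γ → ι → L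
  β_mul : ∀ γ δ, β (γ * δ) = β γ + galAct f ρ γ (β δ)
  y : ι → L
  artinSchreier_β : ∀ γ i, artinSchreier p L (β γ i) = y i - galAct f ρ γ y i
  exists_mem_ker : ∀ c : ι → ZMod p, ∃ a ∈ f.ker, β a = fun i => c i • 1
  eq_one_of_mem_ker : ∀ a ∈ f.ker, β a = 0 → a = 1

theorem exists_artinSchreierCocycle {p : ℕ} [Fact p.Prime] {k L : Type*} [Field k] [Field L]
    [Algebra k L] [FiniteDimensional k L] [IsGalois k L] [Algebra (ZMod p) L] [CharP L p]
    {Γ : Type*} [Group Γ] (f : Γ →* (L ≃ₐ[k] L)) (hf : Function.Surjective f) {ι : Type*}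
    [Fintype ι] [DecidableEq ι] [Nonempty ι]
    (ρ : Γ →* Matrix ι ι (ZMod p)) (hρ : ∀ a ∈ f.ker, ρ a = 1)
    (e : f.ker → ι → ZMod p) (hbij : Function.Bijective e)
    (he : ∀ a b, e (a * b) = e a + e b)
    (hconj : ∀ (γ : Γ) (a b : f.ker), (b : Γ) = γ * a * γ⁻¹ → e b = (ρ γ).mulVec (e a))
    (hL : ∀ u : L, u ≠ 0 → ∃ t : k, ∀ s : L, artinSchreier p L s ≠ t • u) :
    ∃ D : ArtinSchreierCocycle p f ι, ∀ x : ι → L, (fun i => artinSchreier p L (x i)) ≠ D.y := by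
  obtain ⟨β, hβ, hβker⟩ := exists_cocycle_extending f hf ρ e he hconj
  have hκ : ∀ γ δ, (fun i => artinSchreier p L (β (γ * δ) i)) =
      (fun i => artinSchreier p L (β γ i)) +
        galAct f ρ γ (fun i => artinSchreier p L (β δ i)) := by
    intro γ δ
    ext i
    rw [hβ, Pi.add_apply, map_add, artinSchreier_semilinearAct]
    rfl
  have hκker : ∀ a ∈ f.ker, (fun i => artinSchreier p L (β a i)) = 0 := by
    intro a ha
    ext i
    rw [hβker ⟨a, ha⟩]
    exact (artinSchreier_eq_zero_iff p).2 ⟨_, rfl⟩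
  obtain ⟨y, hy⟩ := exists_eq_sub_galAct f hf ρ hκ hκker
  obtain ⟨z, hz, hzne⟩ := exists_galAct_eq_self_and_artinSchreier_ne f hf ρ hρ hL
  obtain ⟨y', hy', hne⟩ : ∃ y' : ι → L,
      (∀ γ, (fun i => artinSchreier p L (β γ i)) = y' - galAct f ρ γ y') ∧
        ∀ x : ι → L, (fun i => artinSchreier p L (x i)) ≠ y' := by
    by_cases h : ∀ x : ι → L, (fun i => artinSchreier p L (x i)) ≠ y
    · exact ⟨y, hy, h⟩
    push Not at h
    obtain ⟨x, hx⟩ := h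
    refine ⟨y + z, fun γ => ?_, fun x' hx' => hzne (x' - x) ?_⟩
    · rw [hy γ, map_add, hz, add_sub_add_right_eq_sub]
    · ext i
      have h1 := congrFun hx i
      have h2 := congrFun hx' i
      simp only [Pi.add_apply] at h2
      rw [Pi.sub_apply, map_sub, h2, h1, add_sub_cancel_left]
  exact ⟨{ ρ := ρ, ρ_ker := hρ, β := β, β_mul := hβ, y := y'
           artinSchreier_β := fun γ i => congrFun (hy' γ) i
           exists_mem_ker := fun c => by
            obtain ⟨a, rfl⟩ := hbij.2 c
            exact ⟨a, a.2, hβker a⟩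
           eq_one_of_mem_ker := fun a ha h => by
            have h1 : (1 : f.ker) = ⟨a, ha⟩ := by
              apply hbij.1
              have h2 : e 1 = 0 := by simpa using he 1 1
              rw [h2]
              ext i
              have h3 := congrFun (hβker ⟨a, ha⟩) i
              rw [h, Pi.zero_apply, ← Algebra.algebraMap_eq_smul_one] at h3
              exact (map_eq_zero _).1 h3.symm |>.symm
            exact (congrArg Subtype.val h1).symm }, hne⟩

namespace ArtinSchreierCocycle

variable {p : ℕ} [Fact p.Prime] {k L : Type*} [Field k] [Field L]
  [Algebra k L] [Algebra (ZMod p) L] [CharP L p] {Γ : Type*} [Group Γ] {f : Γ →* (L ≃ₐ[k] L)}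
  {ι : Type*} [Fintype ι] [DecidableEq ι] (D : ArtinSchreierCocycle p f ι)

theorem β_one : D.β 1 = 0 := by
  have h := D.β_mul 1 1
  rw [galAct_of_mem_ker f D.ρ (one_mem _) (map_one _), mul_one] at h
  simpa using h

theorem β_mul_of_mem_ker {a : Γ} (ha : a ∈ f.ker) (γ : Γ) : D.β (a * γ) = D.β a + D.β γ := by
  rw [D.β_mul, galAct_of_mem_ker f D.ρ ha (D.ρ_ker a ha)]

theorem eq_of_β_eq {γ δ : Γ} (h : f γ = f δ) (hβ : D.β γ = D.β δ) : γ = δ := by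
  have hker : γ * δ⁻¹ ∈ f.ker := by simp [MonoidHom.mem_ker, h]
  have h1 := D.β_mul_of_mem_ker hker δ
  rw [inv_mul_cancel_right, hβ, right_eq_add] at h1
  exact mul_inv_eq_one.1 (D.eq_one_of_mem_ker _ hker h1)

variable {E : Type*} [Field E] [Algebra L E] [Algebra (ZMod p) E]

/-- `σ` and `γ` are related when `σ` acts on `L` through `f γ`, and on the vector `x` through the
value of the cocycle at `γ`. -/
def Rel (x : ι → E) (σ : E →+* E) (γ : Γ) : Prop :=
  (∀ l : L, σ (algebraMap L E l) = algebraMap L E (f γ l)) ∧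
    ∀ i, semilinearAct (D.ρ γ) (σ : E →+ E) x i = x i - algebraMap L E (D.β γ i)

variable {D} {x : ι → E}

theorem exists_rel [CharP E p] (hx : ∀ i, artinSchreier p E (x i) = algebraMap L E (D.y i))
    (hf : Function.Surjective f) (σ : E →+* E) (τ : L ≃ₐ[k] L)
    (hσ : ∀ l : L, σ (algebraMap L E l) = algebraMap L E (τ l)) :
    ∃ γ, f γ = τ ∧ D.Rel x σ γ := by
  obtain ⟨γ, rfl⟩ := hf τ
  have h0 : ∀ i, artinSchreier p E
      (x i - algebraMap L E (D.β γ i) - semilinearAct (D.ρ γ) (σ : E →+ E) x i) = 0 := by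
    intro i
    have h1 : algebraMap L E (galAct f D.ρ γ D.y i) =
        semilinearAct (D.ρ γ) (σ : E →+ E) (fun j => algebraMap L E (D.y j)) i :=
      map_semilinearAct (φ := (algebraMap L E : L →+ E)) (ψ := (algebraMap L E : L →+ E)) (D.ρ γ)
        (fun l => (hσ l).symm) D.y i
    rw [map_sub, map_sub, hx, ← map_artinSchreier, D.artinSchreier_β, artinSchreier_semilinearAct,
      map_sub, h1]
    simp_rw [hx]
    ring
  choose c hc using fun i => (artinSchreier_eq_zero_iff p).1 (h0 i)
  obtain ⟨a, ha, hac⟩ := D.exists_mem_ker c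
  have hfa : f (a * γ) = f γ := by
    rw [map_mul, MonoidHom.mem_ker.1 ha, one_mul]
  refine ⟨a * γ, hfa, by rwa [hfa], fun i => ?_⟩
  have hci : algebraMap L E (c i • 1) = c i • 1 := by
    rw [ZMod.map_smul (algebraMap L E), map_one]
  rw [map_mul, D.ρ_ker a ha, one_mul, D.β_mul_of_mem_ker ha, hac, Pi.add_apply, map_add, hci, hc]
  ring

theorem Rel.unique {σ : E →+* E} {γ δ : Γ} (hγ : D.Rel x σ γ) (hδ : D.Rel x σ δ)
    (h : f γ = f δ) : γ = δ := by
  have hker : γ * δ⁻¹ ∈ f.ker := by simp [MonoidHom.mem_ker, h]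
  have hρ : D.ρ γ = D.ρ δ := by
    rw [← inv_mul_cancel_right γ δ, map_mul, D.ρ_ker _ hker, one_mul]
  refine D.eq_of_β_eq h (funext fun i => (algebraMap L E).injective ?_)
  have h1 := hγ.2 i
  rw [hρ, hδ.2 i] at h1
  exact (sub_right_injective h1).symm

theorem Rel.mul {σ τ : E →+* E} {γ δ : Γ} (hγ : D.Rel x σ γ) (hδ : D.Rel x τ δ) :
    D.Rel x (σ.comp τ) (γ * δ) := by
  refine ⟨fun l => by simp [hδ.1, hγ.1], fun i => ?_⟩
  have h1 : algebraMap L E (galAct f D.ρ γ (D.β δ) i) =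
      semilinearAct (D.ρ γ) (σ : E →+ E) (fun j => algebraMap L E (D.β δ j)) i :=
    map_semilinearAct (φ := (algebraMap L E : L →+ E)) (ψ := (algebraMap L E : L →+ E)) (D.ρ γ)
      (fun l => (hγ.1 l).symm) (D.β δ) i
  have h2 : semilinearAct (D.ρ δ) (τ : E →+ E) x = x - fun j => algebraMap L E (D.β δ j) :=
    funext hδ.2
  have h3 : semilinearAct (D.ρ (γ * δ)) ((σ.comp τ : E →+* E) : E →+ E) x i =
      semilinearAct (D.ρ γ) (σ : E →+ E) (semilinearAct (D.ρ δ) (τ : E →+ E) x) i := by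
    rw [semilinearAct_semilinearAct, map_mul]
    rfl
  rw [h3, h2, map_sub, Pi.sub_apply, hγ.2, ← h1, D.β_mul, Pi.add_apply, map_add]
  ring

theorem Rel.apply_eq {σ : E →+* E} (h : D.Rel x σ 1) (i : ι) : σ (x i) = x i := by
  have h1 := h.2 i
  have h2 : semilinearAct (D.ρ 1) (σ : E →+ E) x i = σ (x i) := by
    have := semilinearAct_one (p := p) (fun j => σ (x j))
    rw [map_one]
    exact congrFun this i
  rwa [h2, D.β_one, Pi.zero_apply, map_zero, sub_zero] at h1

theorem Rel.exists_apply_eq {σ : E →+* E} {γ : Γ} (h : D.Rel x σ γ) (i : ι) :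
    σ (x i) = ∑ j, D.ρ γ⁻¹ i j • (x j - algebraMap L E (D.β γ j)) := by
  have h2 : semilinearAct (D.ρ γ) (σ : E →+ E) x = fun j => x j - algebraMap L E (D.β γ j) :=
    funext h.2
  have h3 := semilinearAct_semilinearAct (D.ρ γ⁻¹) (D.ρ γ) (AddMonoidHom.id E) (σ : E →+ E) x
  rw [h2, ← map_mul, inv_mul_cancel, map_one, AddMonoidHom.id_comp] at h3
  have h4 := semilinearAct_one (p := p) (fun j => σ (x j))
  have h5 : semilinearAct (1 : Matrix ι ι (ZMod p)) (σ : E →+ E) x = fun j => σ (x j) := h4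
  rw [h5] at h3
  exact (congrFun h3 i).symm

end ArtinSchreierCocycle

theorem exists_galois_extension_of_artinSchreierCocycle (p : ℕ) [Fact p.Prime] {k L : Type}
    [Field k] [Field L] [Algebra k L] [FiniteDimensional k L] [IsGalois k L] [Algebra (ZMod p) L]
    [CharP L p] {Γ : Type*} [Group Γ] {f : Γ →* (L ≃ₐ[k] L)} (hf : Function.Surjective f)
    {ι : Type*} [Fintype ι] [DecidableEq ι] (D : ArtinSchreierCocycle p f ι) :
    ∃ (K : Type) (_ : Field K) (_ : Algebra k K) (_ : Algebra L K) (_ : IsScalarTower k L K)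
      (_ : FiniteDimensional k K) (_ : IsGalois k K) (_ : CharP K p) (x : ι → K),
      (∀ i, artinSchreier p K (x i) = algebraMap L K (D.y i)) ∧
        IntermediateField.adjoin L (Set.range x) = ⊤ := by
  let Ω := AlgebraicClosure L
  have : CharP Ω p := charP_of_injective_algebraMap (algebraMap L Ω).injective p
  have hp := (Fact.out : p.Prime).one_lt
  have hpoly : ∀ a : L, (Polynomial.X ^ p - Polynomial.X - Polynomial.C a : Polynomial L).degree =
      (p : WithBot ℕ) := by
    intro a
    rw [sub_sub, Polynomial.degree_sub_eq_left_of_degree_lt, Polynomial.degree_X_pow]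
    rw [Polynomial.degree_X_pow, Polynomial.degree_X_add_C]
    exact_mod_cast hp
  have hroot : ∀ i, ∃ x : Ω, artinSchreier p Ω x = algebraMap L Ω (D.y i) := by
    intro i
    obtain ⟨x, hx⟩ := IsAlgClosed.exists_aeval_eq_zero Ω
      (Polynomial.X ^ p - Polynomial.X - Polynomial.C (D.y i)) (by
        rw [hpoly]
        exact_mod_cast (by omega : p ≠ 0))
    refine ⟨x, ?_⟩
    rw [artinSchreier_apply]
    simpa [sub_eq_zero] using hx
  choose x hx using hroot
  have hsep : ∀ i, IsSeparable L (x i) := by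
    intro i
    have h1 : (Polynomial.X ^ p - Polynomial.X - Polynomial.C (D.y i)).Separable := by
      rw [Polynomial.separable_def]
      have : Polynomial.derivative (Polynomial.X ^ p - Polynomial.X - Polynomial.C (D.y i)) =
          -1 := by simp [Polynomial.derivative_X_pow]
      rw [this]
      exact isCoprime_one_right.neg_right
    refine h1.of_dvd (minpoly.dvd L (x i) ?_)
    have := hx i
    rw [artinSchreier_apply] at this
    simp [this]
  let K : IntermediateField L Ω := IntermediateField.adjoin L (Set.range x)
  have hxK : ∀ i, x i ∈ K := fun i => IntermediateField.subset_adjoin L _ ⟨i, rfl⟩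
  have : FiniteDimensional L K := IntermediateField.finiteDimensional_adjoin fun _ _ =>
    Algebra.IsIntegral.isIntegral _
  have : FiniteDimensional k K := FiniteDimensional.trans k L K
  have : Algebra.IsSeparable L K := by
    rw [IntermediateField.isSeparable_adjoin_iff_isSeparable]
    rintro _ ⟨i, rfl⟩
    exact hsep i
  have : Algebra.IsSeparable k K := Algebra.IsSeparable.trans k L K
  have : Algebra.IsAlgebraic k Ω := Algebra.IsAlgebraic.trans k L Ω
  have : IsAlgClosure k Ω := ⟨inferInstance, inferInstance⟩
  have : Normal k Ω := IsAlgClosure.normal k Ω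
  have : Normal k (K.restrictScalars k) := by
    rw [IntermediateField.normal_iff_forall_map_le]
    intro σ
    have hσL : ∀ l : L, σ (algebraMap L Ω l) = algebraMap L Ω (σ.restrictNormal' L l) :=
      fun l => (AlgHom.restrictNormal_commutes σ L l).symm
    obtain ⟨γ, -, hγ⟩ := ArtinSchreierCocycle.exists_rel hx hf (σ : Ω →+* Ω) _ hσL
    rintro _ ⟨z, hz, rfl⟩
    change σ z ∈ K
    change z ∈ K at hz
    induction hz using IntermediateField.adjoin_induction with
    | mem z hz =>
      obtain ⟨i, rfl⟩ := hz
      have h1 : σ (x i) = _ := hγ.exists_apply_eq i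
      rw [h1]
      refine sum_mem fun j _ => ?_
      rw [← ZMod.intCast_zmod_cast (D.ρ γ⁻¹ i j), Int.cast_smul_eq_zsmul]
      exact zsmul_mem (sub_mem (hxK j) (K.algebraMap_mem _)) _
    | algebraMap l =>
      rw [hσL]
      exact K.algebraMap_mem _
    | add a b _ _ ha hb => rw [map_add]; exact add_mem ha hb
    | inv a _ ha => rw [map_inv₀]; exact inv_mem ha
    | mul a b _ _ ha hb => rw [map_mul]; exact mul_mem ha hb
  have : Normal k K := this
  have : IsGalois k K := ⟨⟩
  have : CharP K p := charP_of_injective_algebraMap (algebraMap L K).injective p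
  refine ⟨K, inferInstance, inferInstance, inferInstance, inferInstance, inferInstance,
    inferInstance, inferInstance, fun i => ⟨x i, hxK i⟩, fun i => Subtype.ext (hx i), ?_⟩
  apply IntermediateField.lift_injective
  rw [IntermediateField.lift_adjoin, IntermediateField.lift_top, ← Set.range_comp]
  rfl

/-- A `p`-embedding problem whose kernel is a minimal normal subgroup is properly solvable, given a
cocycle whose associated vector `y` is not in the image of `artinSchreier`. -/
theorem exists_proper_solution_of_artinSchreierCocycle (p : ℕ) [Fact p.Prime] {k L : Type}
    [Field k] [Field L] [Algebra k L] [FiniteDimensional k L] [IsGalois k L] [Algebra (ZMod p) L]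
    [CharP L p] {Γ : Type*} [Group Γ] {f : Γ →* (L ≃ₐ[k] L)} (hf : Function.Surjective f)
    (hcomm : ∀ a ∈ f.ker, ∀ b ∈ f.ker, a * b = b * a)
    (hmin : ∀ N : Subgroup Γ, N.Normal → N ≤ f.ker → N ≠ ⊥ → N = f.ker)
    {ι : Type*} [Fintype ι] [DecidableEq ι] (D : ArtinSchreierCocycle p f ι)
    (hy : ∀ x : ι → L, (fun i => artinSchreier p L (x i)) ≠ D.y) :
    ∃ (K : Type) (_ : Field K) (_ : Algebra k K) (_ : Algebra L K)
      (_ : IsScalarTower k L K) (_ : FiniteDimensional k K) (_ : IsGalois k K)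
      (ψ : (K ≃ₐ[k] K) ≃* Γ),
      ∀ σ : K ≃ₐ[k] K, f (ψ σ) = AlgEquiv.restrictNormal σ L := by
  obtain ⟨K, _, _, _, _, _, _, _, x, hx, hK⟩ :=
    exists_galois_extension_of_artinSchreierCocycle p hf D
  let : Algebra (ZMod p) K := ZMod.algebra K p
  have hrel : ∀ σ : K ≃ₐ[k] K, ∃ γ, f γ = AlgEquiv.restrictNormal σ L ∧ D.Rel x (σ : K →+* K) γ :=
    fun σ => ArtinSchreierCocycle.exists_rel hx hf _ _
      fun l => (AlgEquiv.restrictNormal_commutes σ L l).symm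
  choose ψ₀ hψf hψ using hrel
  let ψ : (K ≃ₐ[k] K) →* Γ := MonoidHom.mk' ψ₀ fun σ τ => by
    refine (hψ (σ * τ)).unique ((hψ σ).mul (hψ τ)) ?_
    rw [map_mul, hψf, hψf, hψf]
    exact map_mul (AlgEquiv.restrictNormalHom L) σ τ
  have hext : ∀ σ : K ≃ₐ[k] K, (∀ l, σ (algebraMap L K l) = algebraMap L K l) →
      (∀ i, σ (x i) = x i) → σ = 1 := by
    intro σ hl hi
    ext z
    have hz : z ∈ IntermediateField.adjoin L (Set.range x) := hK ▸ IntermediateField.mem_top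
    change σ z = z
    induction hz using IntermediateField.adjoin_induction with
    | mem z hz =>
      obtain ⟨i, rfl⟩ := hz
      exact hi i
    | algebraMap l => exact hl l
    | add a b _ _ ha hb => rw [map_add, ha, hb]
    | inv a _ ha => rw [map_inv₀, ha]
    | mul a b _ _ ha hb => rw [map_mul, ha, hb]
  have hinj : Function.Injective ψ := by
    rw [injective_iff_map_eq_one]
    intro σ hσ
    have h1 : D.Rel x (σ : K →+* K) 1 := hσ ▸ hψ σ
    refine hext σ (fun l => ?_) fun i => h1.apply_eq i
    simpa using h1.1 l
  have hrange : ∀ γ, ∃ σ, f (ψ σ) = f γ := by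
    intro γ
    obtain ⟨σ, hσ⟩ := AlgEquiv.restrictNormalHom_surjective (F := k) (K₁ := L) K (f γ)
    exact ⟨σ, (hψf σ).trans hσ⟩
  have hker : f.ker ≤ ψ.range := by
    have hnormal : (ψ.range ⊓ f.ker).Normal := by
      refine ⟨fun a ha γ => ?_⟩
      obtain ⟨σ, hσ⟩ := hrange γ
      have h1 : γ * (ψ σ)⁻¹ ∈ f.ker := by simp [MonoidHom.mem_ker, hσ]
      have h2 : ψ σ * a * (ψ σ)⁻¹ ∈ f.ker := (MonoidHom.normal_ker f).conj_mem a ha.2 _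
      have h3 : γ * a * γ⁻¹ = ψ σ * a * (ψ σ)⁻¹ := by
        calc γ * a * γ⁻¹ = γ * (ψ σ)⁻¹ * (ψ σ * a * (ψ σ)⁻¹) * (γ * (ψ σ)⁻¹)⁻¹ := by group
          _ = _ := by rw [hcomm _ h1 _ h2, mul_inv_cancel_right]
      rw [h3]
      exact ⟨ψ.range.mul_mem (ψ.range.mul_mem ⟨σ, rfl⟩ ha.1) (ψ.range.inv_mem ⟨σ, rfl⟩), h2⟩
    by_cases hbot : ψ.range ⊓ f.ker = ⊥
    · exfalso
      have hfix : ∀ σ : K ≃ₐ[L] K, ∀ i, σ (x i) = x i := by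
        intro σ i
        have h1 : f (ψ (σ.restrictScalars k)) = 1 := by
          ext l
          apply (algebraMap L K).injective
          exact ((hψ (σ.restrictScalars k)).1 l).symm.trans (σ.commutes l)
        have h2 : ψ (σ.restrictScalars k) ∈ ψ.range ⊓ f.ker := ⟨⟨_, rfl⟩, h1⟩
        rw [hbot, Subgroup.mem_bot, ← map_one ψ] at h2
        exact DFunLike.congr_fun (hinj h2) (x i)
      have : IsGalois L K := IsGalois.tower_top_of_isGalois k L K
      have : FiniteDimensional L K := FiniteDimensional.right k L K
      have hmem : ∀ i, ∃ l : L, algebraMap L K l = x i := fun i =>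
        (IsGalois.mem_range_algebraMap_iff_fixed (x i)).2 fun σ => hfix σ i
      choose l hl using hmem
      refine hy l (funext fun i => (algebraMap L K).injective ?_)
      rw [map_artinSchreier, hl, hx]
    · exact (hmin _ hnormal inf_le_right hbot).symm.le.trans inf_le_left
  have hsurj : Function.Surjective ψ := by
    intro γ
    obtain ⟨σ, hσ⟩ := hrange γ
    obtain ⟨τ, hτ⟩ := hker (show γ * (ψ σ)⁻¹ ∈ f.ker by simp [MonoidHom.mem_ker, hσ])
    exact ⟨τ * σ, by rw [map_mul, hτ, inv_mul_cancel_right]⟩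
  exact ⟨K, _, _, _, ‹_›, ‹_›, ‹_›, MulEquiv.ofBijective ψ ⟨hinj, hsurj⟩, hψf⟩

/-- A nontrivial normal `p`-subgroup of a finite group contains a minimal nontrivial normal
subgroup, which is elementary abelian. -/
theorem IsPGroup.exists_minimal_normal {p : ℕ} [Fact p.Prime] {Γ : Type*} [Group Γ] [Finite Γ]
    {H : Subgroup Γ} [hn : H.Normal] (hp : IsPGroup p H) (hne : H ≠ ⊥) :
    ∃ A : Subgroup Γ, A.Normal ∧ A ≤ H ∧ A ≠ ⊥ ∧ (∀ a ∈ A, ∀ b ∈ A, a * b = b * a) ∧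
      (∀ a ∈ A, a ^ p = 1) ∧ ∀ N : Subgroup Γ, N.Normal → N ≤ A → N ≠ ⊥ → N = A := by
  obtain ⟨A, hAH, ⟨hAn, hA⟩, hmin⟩ :=
    (Set.toFinite {N : Subgroup Γ | N.Normal ∧ N ≠ ⊥}).exists_le_minimal
      (show H ∈ {N : Subgroup Γ | N.Normal ∧ N ≠ ⊥} from ⟨hn, hne⟩)
  have hmin' : ∀ N : Subgroup Γ, N.Normal → N ≤ A → N ≠ ⊥ → N = A :=
    fun N hN hNA hN' => le_antisymm hNA (hmin ⟨hN, hN'⟩ hNA)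
  have hpA : IsPGroup p A := hp.to_le hAH
  have : Nontrivial A := (Subgroup.nontrivial_iff_ne_bot A).2 hA
  have hcomm : ∀ a ∈ A, ∀ b ∈ A, a * b = b * a := by
    have := hpA.center_nontrivial
    have h1 := hmin' ((Subgroup.center A).map A.subtype) inferInstance
      (Subgroup.map_subtype_le _) (by
        rw [ne_eq, Subgroup.map_eq_bot_iff_of_injective _ A.subtype_injective]
        exact (Subgroup.nontrivial_iff_ne_bot _).1 this)
    intro a ha b hb
    rw [← h1] at ha
    obtain ⟨a, ha, rfl⟩ := ha
    exact congrArg Subtype.val (Subgroup.mem_center_iff.1 ha ⟨b, hb⟩).symm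
  refine ⟨A, hAn, hAH, hA, hcomm, ?_, hmin'⟩
  let T : Subgroup Γ :=
    { carrier := {a | a ∈ A ∧ a ^ p = 1}
      mul_mem' := fun {a b} ha hb =>
        ⟨mul_mem ha.1 hb.1, by
          rw [Commute.mul_pow (hcomm a ha.1 b hb.1), ha.2, hb.2, one_mul]⟩
      one_mem' := ⟨one_mem A, one_pow p⟩
      inv_mem' := fun {a} ha => ⟨inv_mem ha.1, by rw [inv_pow, ha.2, inv_one]⟩ }
  have hT : T = A := by
    refine hmin' T ⟨fun a ha γ => ⟨hAn.conj_mem a ha.1 γ, ?_⟩⟩ (fun a ha => ha.1) ?_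
    · rw [conj_pow, ha.2, mul_one, mul_inv_cancel]
    · have hdvd : p ∣ Nat.card A := by
        obtain ⟨n, hn⟩ := IsPGroup.iff_card.1 hpA
        have : n ≠ 0 := by
          rintro rfl
          rw [pow_zero] at hn
          exact (Finite.one_lt_card (α := A)).ne' hn
        rw [hn]
        exact dvd_pow_self p this
      obtain ⟨a, ha⟩ := exists_prime_orderOf_dvd_card' p hdvd
      intro hbot
      have h1 : (a : Γ) ∈ T := ⟨a.2, by
        rw [← ha]
        exact congrArg Subtype.val (pow_orderOf_eq_one a)⟩
      rw [hbot, Subgroup.mem_bot, OneMemClass.coe_eq_one] at h1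
      rw [h1, orderOf_one] at ha
      exact (Fact.out : p.Prime).one_lt.ne ha
  intro a ha
  rw [← hT] at ha
  exact ha.2

/-- Over a field with a discrete valuation, a finite embedding problem whose kernel is a minimal
normal subgroup isomorphic to the additive group of an `𝔽_p`-vector space is properly solvable. -/
theorem AbsoluteValue.IsDiscrete.exists_proper_solution_of_addEquiv {p : ℕ} [Fact p.Prime]
    {k L : Type} [Field k] [CharP k p] {v : AbsoluteValue k ℝ} (hv : v.IsDiscrete) [Field L]
    [Algebra k L] [FiniteDimensional k L] [IsGalois k L] {Γ : Type} [Group Γ]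
    {f : Γ →* (L ≃ₐ[k] L)} (hf : Function.Surjective f)
    (hmin : ∀ N : Subgroup Γ, N.Normal → N ≤ f.ker → N ≠ ⊥ → N = f.ker) {V : Type}
    [AddCommGroup V] [Module (ZMod p) V] [Finite V] [Nontrivial V] (φ : Additive f.ker ≃+ V) :
    ∃ (K : Type) (_ : Field K) (_ : Algebra k K) (_ : Algebra L K)
      (_ : IsScalarTower k L K) (_ : FiniteDimensional k K) (_ : IsGalois k K)
      (ψ : (K ≃ₐ[k] K) ≃* Γ),
      ∀ σ : K ≃ₐ[k] K, f (ψ σ) = AlgEquiv.restrictNormal σ L := by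
  have : CharP L p := charP_of_injective_algebraMap (algebraMap k L).injective p
  let : Algebra (ZMod p) L := ZMod.algebra L p
  obtain ⟨w, hw, hπ⟩ := hv.exists_valuation L
  have hcomm : ∀ a ∈ f.ker, ∀ b ∈ f.ker, a * b = b * a := fun a ha b hb =>
    congrArg (fun c : Additive f.ker => (c.toMul : Γ)) (φ.injective
      (by rw [map_add, map_add, add_comm] :
        φ (Additive.ofMul ⟨a, ha⟩ + Additive.ofMul ⟨b, hb⟩) =
          φ (Additive.ofMul ⟨b, hb⟩ + Additive.ofMul ⟨a, ha⟩)))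
  have : Module.Finite (ZMod p) V := Module.Finite.of_finite
  let b := Module.finBasis (ZMod p) V
  have : Nonempty (Fin (Module.finrank (ZMod p) V)) := b.index_nonempty
  let conj : Γ → V →ₗ[ZMod p] V := fun γ =>
    ((φ : Additive f.ker →+ V).comp
      ((MulAut.conjNormal γ : f.ker ≃* f.ker).toMonoidHom.toAdditive.comp (φ.symm : V →+ Additive f.ker))).toZModLinearMap p
  have hconj : ∀ γ (a : f.ker), conj γ (φ (Additive.ofMul a)) =
      φ (Additive.ofMul (MulAut.conjNormal γ a)) := fun γ a =>
    congrArg (fun c : Additive f.ker => φ (Additive.ofMul (MulAut.conjNormal γ c.toMul)))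
      (φ.symm_apply_apply (Additive.ofMul a))
  have hconj1 : ∀ a ∈ f.ker, conj a = 1 := by
    intro a ha
    ext c
    obtain ⟨c, rfl⟩ := φ.surjective c
    rw [← ofMul_toMul c, hconj]
    have h1 : MulAut.conjNormal a c.toMul = c.toMul := by
      ext
      rw [MulAut.conjNormal_apply, hcomm a ha _ c.toMul.2, mul_inv_cancel_right]
    rw [h1, Module.End.one_apply]
  have hconj_mul : ∀ γ δ, conj (γ * δ) = conj γ * conj δ := by
    intro γ δ
    ext c
    obtain ⟨c, rfl⟩ := φ.surjective c
    rw [← ofMul_toMul c, Module.End.mul_apply, hconj, hconj, hconj, map_mul, MulAut.mul_apply]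
  let ρ : Γ →* Matrix _ _ (ZMod p) :=
    { toFun := fun γ => LinearMap.toMatrix b b (conj γ)
      map_one' := by rw [hconj1 1 (one_mem _), LinearMap.toMatrix_one]
      map_mul' := fun γ δ => by rw [hconj_mul, LinearMap.toMatrix_mul] }
  obtain ⟨D, hD⟩ := exists_artinSchreierCocycle f hf ρ
    (fun a ha => by
      change LinearMap.toMatrix b b (conj a) = 1
      rw [hconj1 a ha, LinearMap.toMatrix_one])
    (fun a => b.equivFun (φ (Additive.ofMul a)))
    (b.equivFun.bijective.comp (φ.bijective.comp Additive.ofMul.bijective))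
    (fun a c => by rw [ofMul_mul, map_add, map_add])
    (fun γ a c h => by
      have h1 : c = MulAut.conjNormal γ a := Subtype.ext h
      rw [h1, ← hconj]
      exact (LinearMap.toMatrix_mulVec_repr b b (conj γ) _).symm)
    fun u hu => exists_forall_artinSchreier_ne p w hw hπ hu
  exact exists_proper_solution_of_artinSchreierCocycle p hf hcomm hmin D hD

/-- Over a field with a discrete valuation, a finite embedding problem whose kernel is an elementary
abelian minimal normal `p`-subgroup is properly solvable. -/
theorem AbsoluteValue.IsDiscrete.exists_proper_solution_of_minimal {p : ℕ} [Fact p.Prime]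
    {k L : Type} [Field k] [CharP k p] {v : AbsoluteValue k ℝ} (hv : v.IsDiscrete) [Field L]
    [Algebra k L] [FiniteDimensional k L] [IsGalois k L] {Γ : Type} [Group Γ] [Finite Γ]
    {f : Γ →* (L ≃ₐ[k] L)} (hf : Function.Surjective f) (hne : f.ker ≠ ⊥)
    (hcomm : ∀ a ∈ f.ker, ∀ b ∈ f.ker, a * b = b * a) (hpow : ∀ a ∈ f.ker, a ^ p = 1)
    (hmin : ∀ N : Subgroup Γ, N.Normal → N ≤ f.ker → N ≠ ⊥ → N = f.ker) :
    ∃ (K : Type) (_ : Field K) (_ : Algebra k K) (_ : Algebra L K)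
      (_ : IsScalarTower k L K) (_ : FiniteDimensional k K) (_ : IsGalois k K)
      (ψ : (K ≃ₐ[k] K) ≃* Γ),
      ∀ σ : K ≃ₐ[k] K, f (ψ σ) = AlgEquiv.restrictNormal σ L := by
  let : AddCommGroup (Additive f.ker) :=
    { (inferInstance : AddGroup (Additive f.ker)) with
      add_comm := fun a b => congrArg Additive.ofMul
        (Subtype.ext (hcomm _ a.toMul.2 _ b.toMul.2) : a.toMul * b.toMul = b.toMul * a.toMul) }
  let : Module (ZMod p) (Additive f.ker) := AddCommGroup.zmodModule fun a =>
    congrArg Additive.ofMul (Subtype.ext (hpow a.toMul a.toMul.2) : a.toMul ^ p = 1)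
  have : Nontrivial f.ker := (Subgroup.nontrivial_iff_ne_bot _).2 hne
  exact hv.exists_proper_solution_of_addEquiv (p := p) hf hmin (AddEquiv.refl (Additive f.ker))

/-- Over a field with a discrete valuation, every finite `p`-embedding problem is properly
solvable, where `p` is the characteristic. -/
theorem AbsoluteValue.IsDiscrete.exists_proper_solution {p : ℕ} [Fact p.Prime]
    {k L : Type} [Field k] [CharP k p] {v : AbsoluteValue k ℝ} (hv : v.IsDiscrete) [Field L]
    [Algebra k L] [FiniteDimensional k L] [IsGalois k L] {Γ : Type} [Group Γ] [Finite Γ]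
    (f : Γ →* (L ≃ₐ[k] L)) (hf : Function.Surjective f) (hker : IsPGroup p f.ker) :
    ∃ (K : Type) (_ : Field K) (_ : Algebra k K) (_ : Algebra L K)
      (_ : IsScalarTower k L K) (_ : FiniteDimensional k K) (_ : IsGalois k K)
      (ψ : (K ≃ₐ[k] K) ≃* Γ),
      ∀ σ : K ≃ₐ[k] K, f (ψ σ) = AlgEquiv.restrictNormal σ L := by
  induction hn : Nat.card Γ using Nat.strong_induction_on generalizing Γ with
  | _ n ih =>
    by_cases hbot : f.ker = ⊥
    · let φ := MulEquiv.ofBijective f ⟨(MonoidHom.ker_eq_bot_iff f).1 hbot, hf⟩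
      exact ⟨L, inferInstance, inferInstance, inferInstance, inferInstance, inferInstance,
        inferInstance, φ.symm, fun σ => (φ.apply_symm_apply σ).trans
          (DFunLike.congr_fun (AlgEquiv.restrictNormalHom_id k L) σ).symm⟩
    obtain ⟨A, hAn, hAf, hA, hcomm, hpow, hmin⟩ := hker.exists_minimal_normal hbot
    let g : Γ ⧸ A →* (L ≃ₐ[k] L) := QuotientGroup.lift A f hAf
    have hg : Function.Surjective g := QuotientGroup.lift_surjective_of_surjective A f hf hAf
    have hgker : IsPGroup p g.ker := by
      rintro ⟨a, ha⟩
      obtain ⟨a, rfl⟩ := QuotientGroup.mk_surjective a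
      obtain ⟨m, hm⟩ := hker ⟨a, ha⟩
      exact ⟨m, Subtype.ext (congrArg (QuotientGroup.mk (s := A)) (congrArg Subtype.val hm))⟩
    have hcard : Nat.card (Γ ⧸ A) < n := by
      rw [← hn, Subgroup.card_eq_card_quotient_mul_card_subgroup A]
      exact lt_mul_of_one_lt_right Nat.card_pos ((Subgroup.one_lt_card_iff_ne_bot A).2 hA)
    obtain ⟨K₁, _, _, _, _, _, _, ψ₁, hψ₁⟩ := ih _ hcard g hg hgker rfl
    let h : Γ →* (K₁ ≃ₐ[k] K₁) := (ψ₁.symm : Γ ⧸ A →* (K₁ ≃ₐ[k] K₁)).comp (QuotientGroup.mk' A)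
    have hh : Function.Surjective h := ψ₁.symm.surjective.comp (QuotientGroup.mk'_surjective A)
    have hhker : h.ker = A :=
      (MonoidHom.ker_mulEquiv_comp _ ψ₁.symm).trans (QuotientGroup.ker_mk' A)
    obtain ⟨K, _, _, _, _, _, _, ψ, hψ⟩ := hv.exists_proper_solution_of_minimal hh
      (hhker ▸ hA) (hhker ▸ hcomm) (hhker ▸ hpow) (hhker ▸ hmin)
    let : Algebra L K := ((algebraMap K₁ K).comp (algebraMap L K₁)).toAlgebra
    have : IsScalarTower L K₁ K := IsScalarTower.of_algebraMap_eq fun _ => rfl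
    have : IsScalarTower k L K := IsScalarTower.of_algebraMap_eq fun x => by
      rw [IsScalarTower.algebraMap_apply k K₁ K, IsScalarTower.algebraMap_apply k L K₁]
      rfl
    refine ⟨K, inferInstance, inferInstance, inferInstance, inferInstance, inferInstance,
      inferInstance, ψ, fun σ => ?_⟩
    calc f (ψ σ) = g (ψ₁ (h (ψ σ))) :=
          congrArg g (ψ₁.apply_symm_apply (QuotientGroup.mk' A (ψ σ))).symm
      _ = (σ.restrictNormal K₁).restrictNormal L := by rw [hψ₁, hψ]
      _ = σ.restrictNormal L := (IsScalarTower.AlgEquiv.restrictNormalHom_comp_apply L K₁ σ).symm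

/-- Let `k` be a field of characteristic `p > 0` admitting infinitely many pairwise
inequivalent discrete valuations.  Then every finite `p`-embedding problem for `Gal(k)`
is properly solvable: given a finite Galois extension `L/k` and a surjection
`f : Γ → Gal(L/k)` of finite groups with `p`-group kernel, there is a finite Galois
extension `K/k` containing `L` and an isomorphism `ψ : Gal(K/k) ≃ Γ` such that `f ∘ ψ`
is the restriction map `Gal(K/k) → Gal(L/k)`. -/
theorem pEmbeddingProblem_properly_solvable
    (p : ℕ) [Fact p.Prime] (k : Type) [Field k] [CharP k p]
    (hvals : ∃ v : ℕ → AbsoluteValue k ℝ,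
      (∀ n, (v n).IsDiscrete) ∧ ∀ m n, m ≠ n → ¬ (v m).IsEquivalent (v n))
    (L : Type) [Field L] [Algebra k L] [FiniteDimensional k L] [IsGalois k L]
    (Γ : Type) [Group Γ] [Finite Γ]
    (f : Γ →* (L ≃ₐ[k] L)) (hf : Function.Surjective f) (hker : IsPGroup p f.ker) :
    ∃ (K : Type) (_ : Field K) (_ : Algebra k K) (_ : Algebra L K)
      (_ : IsScalarTower k L K) (_ : FiniteDimensional k K) (_ : IsGalois k K)
      (ψ : (K ≃ₐ[k] K) ≃* Γ),
      ∀ σ : K ≃ₐ[k] K, f (ψ σ) = AlgEquiv.restrictNormal σ L := by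
  obtain ⟨v, hv, -⟩ := hvals
  exact (hv 0).exists_proper_solution f hf hker
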